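/- Fix a ∈ [0,1), σ > 0, ε ∈ (0,1) and d ∈ (0, d_max). Then there exists a constant C > 0 such that for all sufficiently large n, the minimum achievable source coding rate of the Gauss-Markov source satisfies R(n, d, ε) ≥ (1/2) log(σ²/d) + Q⁻¹(ε)/√(2n) − C/n. -/

import Mathlib

open MeasureTheory ProbabilityTheory Real Filter Matrix
open scoped NNReal ENNReal

noncomputable section

namespace GM

/-- Law of `n` i.i.d. centered Gaussian random variables with variance `σ²`. -/
def gaussPi (σ : ℝ) (n : ℕ) : Measure (Fin n → ℝ) :=
  Measure.pi fun _ => gaussianReal 0 ⟨σ ^ 2, sq_nonneg σ⟩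

/-- The Gauss-Markov evolution `U_{i+1} = ∑_{j ≤ i} a^(i-j) Z_{j+1}`
(equivalently `U_0 = 0`, `U_i = a U_{i-1} + Z_i`). -/
def evolve (a : ℝ) (n : ℕ) (z : Fin n → ℝ) : Fin n → ℝ :=
  fun i => ∑ j ∈ Finset.Iic i, a ^ ((i : ℕ) - (j : ℕ)) * z j

/-- Law of the Gauss-Markov source vector `(U_1, …, U_n)`. -/
def sourceLaw (a σ : ℝ) (n : ℕ) : Measure (Fin n → ℝ) :=
  (gaussPi σ n).map (evolve a n)

/-- Mean squared error distortion. -/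
def distortion (n : ℕ) (u v : Fin n → ℝ) : ℝ :=
  (1 / (n : ℝ)) * ∑ i, (u i - v i) ^ 2

/-- There exists an `(n, M, d, ε)` excess-distortion code for the Gauss-Markov source. -/
def IsCode (a σ : ℝ) (n M : ℕ) (d ε : ℝ) : Prop :=
  ∃ f : (Fin n → ℝ) → Fin M, ∃ g : Fin M → (Fin n → ℝ),
    Measurable f ∧
    sourceLaw a σ n {u | d < distortion n u (g (f u))} ≤ ENNReal.ofReal ε

/-- Minimum achievable code size. -/
def Mstar (a σ : ℝ) (n : ℕ) (d ε : ℝ) : ℕ := sInf {M | IsCode a σ n M d ε}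

/-- Minimum achievable source coding rate `R(n, d, ε)`. -/
def rate (a σ : ℝ) (n : ℕ) (d ε : ℝ) : ℝ := Real.log (Mstar a σ n d ε) / n

/-- Gaussian tail function `Q`. -/
def gaussQ (t : ℝ) : ℝ := ∫ s in Set.Ioi t, (Real.sqrt (2 * π))⁻¹ * Real.exp (-(s ^ 2) / 2)

/-- Power spectrum of the Gauss-Markov source. -/
def S (a σ w : ℝ) : ℝ := σ ^ 2 / (1 + a ^ 2 - 2 * a * Real.cos w)

/-- The limiting reverse waterfilling equation relating distortion `d` and water level `θ`. -/
def waterEq (a σ θ d : ℝ) : Prop :=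
  d = (1 / (2 * π)) * ∫ w in Set.Icc (-π) π, min θ (S a σ w)

/-- The rate-distortion function `R_U(d)`, parametrized by the water level `θ` matched to `d`. -/
def RU (a σ θ : ℝ) : ℝ :=
  (1 / (2 * π)) * ∫ w in Set.Icc (-π) π, max 0 ((1 / 2) * Real.log (S a σ w / θ))

/-- The dispersion `V_U(d)`, parametrized by the water level `θ` matched to `d`. -/
def VU (a σ θ : ℝ) : ℝ :=
  (1 / (4 * π)) * ∫ w in Set.Icc (-π) π, min 1 ((S a σ w / θ) ^ 2)

/-- The lower bidiagonal matrix `A` with `1` on the diagonal, `-a` on the first subdiagonal. -/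
def Amat (a : ℝ) (n : ℕ) : Matrix (Fin n) (Fin n) ℝ :=
  Matrix.of fun i j => if i = j then 1 else if (i : ℕ) = (j : ℕ) + 1 then -a else 0

/-- `μv` is the nondecreasing enumeration of the eigenvalues (with multiplicity) of the
real symmetric matrix `M`: it is monotone and `M = P D Pᵀ` for some orthogonal `P`. -/
def IsEigs {n : ℕ} (μv : Fin n → ℝ) (M : Matrix (Fin n) (Fin n) ℝ) : Prop :=
  Monotone μv ∧ ∃ P : Matrix (Fin n) (Fin n) ℝ,
    P * Pᵀ = 1 ∧ Pᵀ * P = 1 ∧ M = P * Matrix.diagonal μv * Pᵀ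

/-- The `i`-th entry of `u` (0-based), or `0` if out of range. -/
def entry {n : ℕ} (u : Fin n → ℝ) (i : ℕ) : ℝ := if h : i < n then u ⟨i, h⟩ else 0

/-- Maximum likelihood estimator `â(u) = (∑_{i=1}^{n-1} u_i u_{i+1}) / (∑_{i=1}^{n-1} u_i²)`. -/
def mle {n : ℕ} (u : Fin n → ℝ) : ℝ :=
  (∑ i ∈ Finset.range (n - 1), entry u i * entry u (i + 1)) /
    ∑ i ∈ Finset.range (n - 1), entry u i ^ 2

/-- The `d`-tilted information expression, parametrized by a water level `θ`,
per-coordinate variances `sv`, evaluated at the point `x`. -/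
def Jtilt {n : ℕ} (θ : ℝ) (sv : Fin n → ℝ) (x : Fin n → ℝ) : ℝ :=
  ∑ i, ((min θ (sv i) / (2 * θ)) * ((x i) ^ 2 / sv i - 1)
        + (1 / 2) * Real.log (max θ (sv i) / θ))

end GM

namespace GM

def phi (h y : ℝ) : ℝ := Real.exp (-((Real.exp (h * y) - 1 - h * y) / h ^ 2))

lemma exp_sub_le (x y c : ℝ) (hx : x ≤ c) (hy : y ≤ c) :
    |Real.exp x - Real.exp y| ≤ |x - y| * Real.exp c := by
  have key : ∀ p q : ℝ, q ≤ p → p ≤ c → Real.exp p - Real.exp q ≤ (p - q) * Real.exp c := by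
    intro p q hqp hpc
    have h1 : Real.exp q = Real.exp p * Real.exp (q - p) := by rw [← Real.exp_add]; ring_nf
    have h2 := Real.add_one_le_exp (q - p)
    have h3 := Real.exp_le_exp.mpr hpc
    have h4 := Real.exp_pos p
    nlinarith
  rcases le_total x y with h | h
  · have := key y x h hy
    rw [abs_sub_comm, abs_sub_comm x, abs_of_nonneg, abs_of_nonneg (by linarith)]
    · exact this
    · have := Real.exp_le_exp.mpr h; linarith
  · have := key x y h hx
    rw [abs_of_nonneg, abs_of_nonneg (by linarith)]
    · exact this
    · have := Real.exp_le_exp.mpr h; linarith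

lemma exp_tail (u : ℝ) (hu : 1 < |u|) : |u| / 3 ≤ Real.exp u - 1 - u := by
  rcases lt_abs.mp hu with h | h
  · rw [abs_of_pos (by linarith)]
    have := Real.quadratic_le_exp_of_nonneg (show 0 ≤ u by linarith)
    nlinarith
  · rw [abs_of_neg (by linarith)]
    by_cases h2 : u ≤ -2
    · have := Real.exp_pos u
      linarith
    · push Not at h2
      have h1 : Real.exp u = Real.exp (-1) * Real.exp (u + 1) := by rw [← Real.exp_add]; ring_nf
      have h3 := Real.add_one_le_exp (u + 1)
      have h4 : (1 : ℝ) / 3 ≤ Real.exp (-1) := by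
        rw [Real.exp_neg, one_div]
        exact inv_anti₀ (Real.exp_pos 1) (by have := Real.exp_one_lt_d9; linarith)
      nlinarith

lemma phi_close (h y : ℝ) (h0 : 0 < h) (h1 : h ≤ 1 / 3) :
    |phi h y - Real.exp (-(y ^ 2) / 2)| ≤ 770 * h * (1 + y ^ 2)⁻¹ := by
  have hpos : 0 < 1 + y ^ 2 := by positivity
  rw [← div_eq_mul_inv, le_div_iff₀ hpos]
  by_cases hu : |h * y| ≤ 1
  · have hb := Real.exp_bound hu (n := 3) (by norm_num)
    simp [Finset.sum_range_succ, Nat.factorial] at hb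
    norm_num at hb
    set u := h * y with hudef
    have hu2 : u ^ 2 = h ^ 2 * y ^ 2 := by rw [hudef]; ring
    have hu3 : |h| ^ 3 * |y| ^ 3 = h ^ 3 * |y| ^ 3 := by rw [abs_of_pos h0]
    have hu3' : |u| ^ 3 = h ^ 3 * |y| ^ 3 := by rw [hudef, abs_mul, mul_pow, abs_of_pos h0]
    have hb' : |Real.exp u - 1 - u - u ^ 2 / 2| ≤ h ^ 3 * |y| ^ 3 * (2 / 9) := by
      have : Real.exp u - 1 - u - u ^ 2 / 2 = Real.exp u - (1 + u + u ^ 2 / 2) := by ring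
      rw [this]
      rw [abs_of_pos h0, mul_pow h |y|] at hb
      exact hb
    have hle : |u| ^ 3 ≤ u ^ 2 := by
      rw [← sq_abs u]; nlinarith [abs_nonneg u, sq_nonneg |u|]
    have hb2 := (abs_le.mp hb').1
    have e1 : -((Real.exp u - 1 - u) / h ^ 2) ≤ -(y ^ 2 / 4) := by
      rw [neg_le_neg_iff, le_div_iff₀ (by positivity)]
      nlinarith [sq_nonneg u]
    have e2 : -(y ^ 2) / 2 ≤ -(y ^ 2 / 4) := by nlinarith [sq_nonneg y]
    have e3 := exp_sub_le _ _ _ e1 e2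
    have e4 : |-((Real.exp u - 1 - u) / h ^ 2) - -(y ^ 2) / 2| ≤ h * |y| ^ 3 * (2 / 9) := by
      have : -((Real.exp u - 1 - u) / h ^ 2) - -(y ^ 2) / 2
          = -((Real.exp u - 1 - u - u ^ 2 / 2) / h ^ 2) := by
        rw [hu2]; field_simp; ring
      rw [this, abs_neg, abs_div, abs_of_pos (show 0 < h ^ 2 by positivity),
        div_le_iff₀ (by positivity)]
      calc _ ≤ _ := hb'
        _ = _ := by ring
    have e5 : |y| ^ 3 * (1 + y ^ 2) * Real.exp (-(y ^ 2 / 4)) ≤ 770 := by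
      rw [Real.exp_neg, ← div_eq_mul_inv, div_le_iff₀ (Real.exp_pos _)]
      have f1 := Real.pow_div_factorial_le_exp (y ^ 2 / 4) (by positivity) 3
      have f2 := Real.one_le_exp (show 0 ≤ y ^ 2 / 4 by positivity)
      simp [Nat.factorial] at f1
      rw [← sq_abs y] at *
      set b := |y|
      have hb0 : 0 ≤ b := abs_nonneg y
      have g1 : b ^ 3 ≤ 1 + b ^ 6 := by nlinarith [sq_nonneg (b ^ 3 - 1), pow_nonneg hb0 3]
      have g2 : b ^ 5 ≤ 1 + b ^ 6 := by
        rcases le_total b 1 with hh | hh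
        · have := pow_le_one₀ hb0 hh (n := 5); have := pow_nonneg hb0 6; linarith
        · have := pow_le_pow_right₀ hh (show 5 ≤ 6 by norm_num); linarith
      have g3 : b ^ 6 = 64 * (b ^ 2 / 4) ^ 3 := by ring
      have g4 : (b ^ 2 / 4) ^ 3 ≤ 6 * Real.exp (b ^ 2 / 4) := by
        linarith
      nlinarith
    unfold phi
    rw [← hudef]
    calc _ ≤ (h * |y| ^ 3 * (2 / 9) * Real.exp (-(y ^ 2 / 4))) * (1 + y ^ 2) := by
            gcongr
            exact e3.trans (by gcongr)
      _ = (2 / 9) * h * (|y| ^ 3 * (1 + y ^ 2) * Real.exp (-(y ^ 2 / 4))) := by ring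
      _ ≤ (2 / 9) * h * 770 := by gcongr
      _ ≤ 770 * h := by linarith
  · push Not at hu
    have ht := exp_tail _ hu
    rw [abs_mul, abs_of_pos h0] at hu ht
    have hy : 3 ≤ |y| := by nlinarith [abs_nonneg y]
    have e1 : phi h y ≤ Real.exp (-|y|) := by
      unfold phi
      apply Real.exp_le_exp.mpr
      rw [neg_le_neg_iff, le_div_iff₀ (by positivity)]
      refine le_trans ?_ ht
      nlinarith [mul_nonneg h0.le (abs_nonneg y)]
    have e2 : Real.exp (-(y ^ 2) / 2) ≤ Real.exp (-|y|) := by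
      apply Real.exp_le_exp.mpr
      rw [← sq_abs y]; nlinarith
    have e3 : |phi h y - Real.exp (-(y ^ 2) / 2)| ≤ Real.exp (-|y|) := by
      have p1 : 0 < phi h y := Real.exp_pos _
      have p2 := Real.exp_pos (-(y ^ 2) / 2)
      rw [abs_le]; constructor <;> linarith
    have e5 : |y| * (1 + y ^ 2) * Real.exp (-|y|) ≤ 7 := by
      rw [Real.exp_neg, ← div_eq_mul_inv, div_le_iff₀ (Real.exp_pos _)]
      have f1 := Real.pow_div_factorial_le_exp |y| (by positivity) 3
      have f2 := Real.add_one_le_exp |y|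
      simp [Nat.factorial] at f1
      rw [← sq_abs y]
      nlinarith
    calc _ ≤ Real.exp (-|y|) * (1 + y ^ 2) := by gcongr
      _ ≤ (h * |y|) * (Real.exp (-|y|) * (1 + y ^ 2)) := by
        apply le_mul_of_one_le_left (by positivity) hu.le
      _ = h * (|y| * (1 + y ^ 2) * Real.exp (-|y|)) := by ring
      _ ≤ h * 7 := by gcongr
      _ ≤ 770 * h := by linarith

lemma phi_cont (h : ℝ) : Continuous (phi h) := by unfold phi; fun_prop

lemma gauss_int : Integrable (fun y : ℝ => Real.exp (-(y ^ 2) / 2)) := by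
  have := integrable_exp_neg_mul_sq (show (0 : ℝ) < 1 / 2 by norm_num)
  refine this.congr (Eventually.of_forall fun y => ?_)
  simp only; congr 1; ring

lemma gauss_total : ∫ y : ℝ, Real.exp (-(y ^ 2) / 2) = Real.sqrt (2 * π) := by
  have := integral_gaussian (1 / 2)
  rw [show (2 * π) = π / (1 / 2) by ring, ← this]
  congr 1; ext y; congr 1; ring

lemma phi_int (h : ℝ) (h0 : 0 < h) (h1 : h ≤ 1 / 3) : Integrable (phi h) := by
  have hd : Integrable (fun y => phi h y - Real.exp (-(y ^ 2) / 2)) := by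
    refine Integrable.mono' (integrable_inv_one_add_sq.const_mul (770 * h)) ?_ ?_
    · exact ((phi_cont h).sub (by fun_prop)).aestronglyMeasurable
    · exact Eventually.of_forall fun y => phi_close h y h0 h1
  have := hd.add gauss_int
  refine this.congr (Eventually.of_forall fun y => ?_)
  simp

lemma phi_set (h : ℝ) (h0 : 0 < h) (h1 : h ≤ 1 / 3) (s : Set ℝ) :
    |(∫ y in s, phi h y) - ∫ y in s, Real.exp (-(y ^ 2) / 2)| ≤ 770 * h * π := by
  rw [← integral_sub (phi_int h h0 h1).integrableOn gauss_int.integrableOn]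
  rw [← Real.norm_eq_abs]
  have hi := integrable_inv_one_add_sq.const_mul (770 * h)
  calc _ ≤ ∫ y in s, 770 * h * (1 + y ^ 2)⁻¹ :=
        norm_integral_le_of_norm_le hi.integrableOn
          (Eventually.of_forall fun y => phi_close h y h0 h1)
    _ ≤ ∫ y, 770 * h * (1 + y ^ 2)⁻¹ :=
        setIntegral_le_integral hi (Eventually.of_forall fun y => by positivity)
    _ = 770 * h * π := by rw [integral_const_mul, integral_univ_inv_one_add_sq]

lemma analysis (ε q : ℝ) (hε : ε ∈ Set.Ioo (0 : ℝ) 1) (hq : gaussQ q = ε) :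
    ∃ C : ℝ, 0 < C ∧ ∀ h : ℝ, 0 < h → h ≤ 1 / 3 → C * h ≤ 1 →
      ∫ y in Set.Iic (q - C * h), phi h y < (1 - ε) * ∫ y, phi h y := by
  obtain ⟨hε0, hε1⟩ := hε
  set A : ℝ := 770 * π with hA
  have hApos : 0 < A := by positivity
  set e : ℝ := Real.exp (-((|q| + 1) ^ 2) / 2) with he
  have hepos : 0 < e := Real.exp_pos _
  refine ⟨3 * A / e, by positivity, ?_⟩
  intro h h0 h1 hC
  set C : ℝ := 3 * A / e with hCdef
  have hCe : C * e = 3 * A := by rw [hCdef]; field_simp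
  have hCpos : 0 < C := by positivity
  have hCh : 0 < C * h := by positivity
  set t := q - C * h with ht
  have b1 := (abs_le.mp (phi_set h h0 h1 (Set.Iic t))).2
  have b2 := (abs_le.mp (phi_set h h0 h1 Set.univ)).1
  rw [setIntegral_univ, setIntegral_univ, gauss_total] at b2
  have hs : 0 < Real.sqrt (2 * π) := by positivity
  have c1 : ∫ y in Set.Ioi q, Real.exp (-(y ^ 2) / 2) = ε * Real.sqrt (2 * π) := by
    rw [← hq, gaussQ, integral_const_mul]; field_simp
  have c2 : (∫ y in Set.Iic q, Real.exp (-(y ^ 2) / 2))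
      + ∫ y in Set.Ioi q, Real.exp (-(y ^ 2) / 2) = Real.sqrt (2 * π) := by
    rw [← gauss_total]
    exact intervalIntegral.integral_Iic_add_Ioi gauss_int.integrableOn gauss_int.integrableOn
  have c3 : (∫ y in Set.Iic q, Real.exp (-(y ^ 2) / 2))
      = (∫ y in Set.Iic t, Real.exp (-(y ^ 2) / 2))
        + ∫ y in Set.Ioc t q, Real.exp (-(y ^ 2) / 2) := by
    rw [← setIntegral_union (Set.Iic_disjoint_Ioc le_rfl) measurableSet_Ioc
      gauss_int.integrableOn gauss_int.integrableOn, Set.Iic_union_Ioc_eq_Iic (by linarith)]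
  have c4 : C * h * e ≤ ∫ y in Set.Ioc t q, Real.exp (-(y ^ 2) / 2) := by
    have : ∫ y in Set.Ioc t q, e = C * h * e := by
      rw [setIntegral_const, Real.volume_real_Ioc_of_le (by linarith), smul_eq_mul]
      rw [ht]; ring
    rw [← this]
    apply setIntegral_mono_on (by simp) gauss_int.integrableOn measurableSet_Ioc
    intro y hy
    apply Real.exp_le_exp.mpr
    have : |y| ≤ |q| + 1 := by
      have h3 := hy.1; have h4 := hy.2
      have := neg_abs_le q; have := le_abs_self q
      rw [abs_le]; constructor <;> linarith
    have := pow_le_pow_left₀ (abs_nonneg y) this 2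
    rw [sq_abs] at this
    linarith
  have d1 : 770 * h * π = A * h := by rw [hA]; ring
  rw [d1] at b1 b2
  have d2 : C * h * e = 3 * (A * h) := by rw [mul_right_comm, hCe]; ring
  have d3 : 0 < A * h := by positivity
  nlinarith
end GM

namespace GM

def gdens (σ : ℝ) (n : ℕ) (q : ℝ) : ℝ :=
  ((Real.sqrt (2 * π * σ ^ 2))⁻¹) ^ n * Real.exp (-q / (2 * σ ^ 2))

lemma gaussPi_eq0 (σ : ℝ) (n : ℕ) :
    gaussPi σ n = Measure.pi fun _ => gaussianReal 0 (Real.toNNReal (σ ^ 2)) := by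
  have h : (⟨σ ^ 2, sq_nonneg σ⟩ : ℝ≥0) = Real.toNNReal (σ ^ 2) :=
    NNReal.eq (Real.coe_toNNReal _ (sq_nonneg σ)).symm
  rw [← h]
  rfl

lemma gaussPi_eq (σ : ℝ) (hσ : 0 < σ) (n : ℕ) :
    gaussPi σ n = volume.withDensity
      (fun z : Fin n → ℝ => ENNReal.ofReal (gdens σ n (∑ i, z i ^ 2))) := by
  set v : ℝ≥0 := Real.toNNReal (σ ^ 2) with hvdef
  have hvr : (v : ℝ) = σ ^ 2 := Real.coe_toNNReal _ (sq_nonneg σ)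
  have hv : v ≠ 0 := by
    intro h
    rw [h] at hvr
    have : 0 < σ ^ 2 := by positivity
    simp only [NNReal.coe_zero] at hvr
    linarith
  have hdens : ∀ z : Fin n → ℝ, gdens σ n (∑ i, z i ^ 2) = ∏ i, gaussianPDFReal 0 v (z i) := by
    intro z
    simp only [gaussianPDFReal, Finset.prod_mul_distrib, Finset.prod_const, Finset.card_univ,
      Fintype.card_fin, hvr, ← Real.exp_sum, gdens, sub_zero]
    congr 2
    rw [← Finset.sum_div, Finset.sum_neg_distrib]
  rw [gaussPi_eq0]
  symm
  apply (Measure.pi_eq _).symm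
  intro s hs
  rw [withDensity_apply _ (MeasurableSet.univ_pi hs)]
  simp_rw [hdens]
  have hint : ∀ i, Integrable (gaussianPDFReal 0 v) (volume.restrict (s i)) :=
    fun i => (integrable_gaussianPDFReal 0 v).integrableOn
  rw [← ofReal_integral_eq_lintegral_ofReal]
  · rw [volume_pi, Measure.restrict_pi_pi, integral_fintype_prod_eq_prod (𝕜 := ℝ)
      (fun _ => gaussianPDFReal 0 v), ENNReal.ofReal_prod_of_nonneg]
    · refine Finset.prod_congr rfl fun i _ => ?_
      rw [gaussianReal_apply_eq_integral 0 hv]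
    · intro i _
      exact integral_nonneg fun x => gaussianPDFReal_nonneg 0 v x
  · rw [volume_pi, Measure.restrict_pi_pi]
    exact Integrable.fintype_prod_dep hint
  · exact Eventually.of_forall fun z => Finset.prod_nonneg fun i _ => gaussianPDFReal_nonneg 0 v _

instance (σ : ℝ) (n : ℕ) : IsProbabilityMeasure (gaussPi σ n) := by
  rw [gaussPi_eq0]; infer_instance

def eball (n : ℕ) (v : Fin n → ℝ) (R : ℝ) : Set (Fin n → ℝ) := {z | ∑ i, (z i - v i) ^ 2 ≤ R ^ 2}

lemma eball_meas (n : ℕ) (v : Fin n → ℝ) (R : ℝ) : MeasurableSet (eball n v R) :=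
  measurableSet_le (by fun_prop) (by fun_prop)

lemma eball_eq (n : ℕ) (v : Fin n → ℝ) (R : ℝ) (hR : 0 ≤ R) :
    eball n v R = (WithLp.toLp 2) ⁻¹' (Metric.closedBall (WithLp.toLp 2 v : EuclideanSpace ℝ (Fin n)) R) := by
  ext z
  simp only [eball, Set.mem_ofPred_eq, Set.mem_preimage, Metric.mem_closedBall]
  rw [EuclideanSpace.dist_eq, Real.sqrt_le_left hR]
  simp [Real.dist_eq, sq_abs]

lemma eball_vol (n : ℕ) (v : Fin n → ℝ) (R : ℝ) (hR : 0 ≤ R) :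
    volume (eball n v R) = ENNReal.ofReal (R ^ n) *
      volume (Metric.ball (0 : EuclideanSpace ℝ (Fin n)) 1) := by
  rw [eball_eq n v R hR, (PiLp.volume_preserving_toLp (Fin n)).measure_preimage
    measurableSet_closedBall.nullMeasurableSet, Measure.addHaar_closedBall _ _ hR]
  simp

lemma bathtub (σ : ℝ) (hσ : 0 < σ) (n : ℕ) (r : ℝ) (hr : 0 ≤ r) (E : Set (Fin n → ℝ))
    (hE : MeasurableSet E) (hvol : volume E ≤ volume (eball n 0 r)) :
    gaussPi σ n E ≤ gaussPi σ n (eball n 0 r) := by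
  set B := eball n 0 r with hB
  have hBm : MeasurableSet B := eball_meas n 0 r
  have hBfin : volume B ≠ ∞ := by
    rw [hB, eball_vol n 0 r hr]
    exact ENNReal.mul_ne_top ENNReal.ofReal_ne_top Metric.isBounded_ball.measure_lt_top.ne
  have hmono : ∀ p q : ℝ, p ≤ q → gdens σ n q ≤ gdens σ n p := by
    intro p q hpq
    unfold gdens
    gcongr
  have hdiff : volume (E \ B) ≤ volume (B \ E) := by
    have h1 := measure_inter_add_sdiff (μ := volume) E hBm
    have h2 := measure_inter_add_sdiff (μ := volume) B hE
    rw [Set.inter_comm B E] at h2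
    have h3 : volume (E ∩ B) ≠ ∞ := ne_top_of_le_ne_top hBfin (measure_mono Set.inter_subset_right)
    rw [← h1, ← h2] at hvol
    exact (ENNReal.add_le_add_iff_left h3).mp hvol
  rw [gaussPi_eq σ hσ n]
  set μ := volume.withDensity
      (fun z : Fin n → ℝ => ENNReal.ofReal (gdens σ n (∑ i, z i ^ 2))) with hμ
  rw [← measure_inter_add_sdiff (μ := μ) E hBm, ← measure_inter_add_sdiff (μ := μ) B hE,
    Set.inter_comm B E]
  refine add_le_add le_rfl ?_
  calc μ (E \ B) ≤ ENNReal.ofReal (gdens σ n (r ^ 2)) * volume (E \ B) := by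
        rw [hμ, withDensity_apply _ (hE.diff hBm), ← setLIntegral_const]
        apply setLIntegral_mono' (hE.diff hBm)
        intro z hz
        have : ¬ (∑ i, (z i - (0 : Fin n → ℝ) i) ^ 2 ≤ r ^ 2) := hz.2
        simp at this
        exact ENNReal.ofReal_le_ofReal (hmono _ _ this.le)
    _ ≤ ENNReal.ofReal (gdens σ n (r ^ 2)) * volume (B \ E) := by gcongr
    _ ≤ μ (B \ E) := by
        rw [hμ, withDensity_apply _ (hBm.diff hE), ← setLIntegral_const]
        apply setLIntegral_mono' (hBm.diff hE)
        intro z hz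
        have : (∑ i, (z i - (0 : Fin n → ℝ) i) ^ 2 ≤ r ^ 2) := hz.1
        simp at this
        exact ENNReal.ofReal_le_ofReal (hmono _ _ this)

def evMat (a : ℝ) (n : ℕ) : Matrix (Fin n) (Fin n) ℝ :=
  Matrix.of fun i j => if j ≤ i then a ^ ((i : ℕ) - (j : ℕ)) else 0

lemma evolve_eq (a : ℝ) (n : ℕ) : evolve a n = Matrix.toLin' (evMat a n) := by
  funext z i
  simp only [evolve, Matrix.toLin'_apply, Matrix.mulVec, dotProduct, evMat, Matrix.of_apply,
    ite_mul, zero_mul]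
  rw [← Finset.sum_filter]
  congr 1
  ext j; simp

lemma evolve_meas (a : ℝ) (n : ℕ) : Measurable (evolve a n) := by
  unfold evolve; fun_prop

lemma evolve_vol (a : ℝ) (n : ℕ) (s : Set (Fin n → ℝ)) :
    volume (evolve a n ⁻¹' s) = volume s := by
  have hdet : LinearMap.det (Matrix.toLin' (evMat a n)) = 1 := by
    rw [LinearMap.det_toLin', Matrix.det_of_isLowerTriangular]
    · simp [evMat]
    · intro i j hij
      have : i < j := hij
      simp [evMat, not_le.mpr this]
  rw [evolve_eq, Measure.addHaar_preimage_linearMap _ (by rw [hdet]; norm_num), hdet]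
  simp

instance (a σ : ℝ) (n : ℕ) : IsProbabilityMeasure (sourceLaw a σ n) :=
  Measure.isProbabilityMeasure_map (evolve_meas a n).aemeasurable

lemma code_exists (a σ : ℝ) (n : ℕ) (hn : 0 < n) (d ε : ℝ) (hd : 0 < d) (hε : 0 < ε) :
    ∃ M, IsCode a σ n M d ε := by
  set e := TopologicalSpace.denseSeq (Fin n → ℝ)
  have hm : TendstoInMeasure (sourceLaw a σ n) (fun N => (SimpleFunc.nearestPt e N : (Fin n → ℝ) → (Fin n → ℝ)))
      atTop id := by
    apply tendstoInMeasure_of_tendsto_ae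
    · intro N
      exact (SimpleFunc.nearestPt e N).measurable.aestronglyMeasurable
    · refine Eventually.of_forall fun x => ?_
      apply SimpleFunc.tendsto_nearestPt
      exact TopologicalSpace.denseRange_denseSeq (Fin n → ℝ) x
  have h1 := hm (ENNReal.ofReal (Real.sqrt d)) (by simpa using hd)
  have h2 := h1.eventually (gt_mem_nhds (show 0 < ENNReal.ofReal ε by simpa using hε))
  obtain ⟨N, hN⟩ := h2.exists
  refine ⟨N + 1, fun u => ⟨SimpleFunc.nearestPtInd e N u,
    Nat.lt_succ_of_le (SimpleFunc.nearestPtInd_le e N u)⟩, fun k => e k, ?_, ?_⟩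
  · have : Measurable (fun u : (Fin n → ℝ) => Fin.ofNat (N + 1) (SimpleFunc.nearestPtInd e N u)) :=
      (Measurable.of_discrete (f := fun k => Fin.ofNat (N + 1) k)).comp
        (SimpleFunc.nearestPtInd e N).measurable
    convert this using 2 with u
    ext
    simp [Nat.mod_eq_of_lt (Nat.lt_succ_of_le (SimpleFunc.nearestPtInd_le e N u))]
  · refine le_trans (measure_mono ?_) hN.le
    intro u hu
    simp only [Set.mem_ofPred_eq] at hu ⊢
    by_contra hcon
    push Not at hcon
    have hdist : dist (SimpleFunc.nearestPt e N u) u < Real.sqrt d := by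
      rw [edist_dist] at hcon
      exact (ENNReal.ofReal_lt_ofReal_iff (Real.sqrt_pos.mpr hd)).mp hcon
    have hle : distortion n u (SimpleFunc.nearestPt e N u) ≤ d := by
      unfold distortion
      have : ∑ i, (u i - SimpleFunc.nearestPt e N u i) ^ 2 ≤ ∑ i : Fin n, d := by
        apply Finset.sum_le_sum
        intro i _
        have h4 := (dist_le_pi_dist (SimpleFunc.nearestPt e N u) u i).trans hdist.le
        rw [Real.dist_eq, abs_sub_comm] at h4
        have h5 := pow_le_pow_left₀ (abs_nonneg _) h4 2
        rwa [sq_abs, Real.sq_sqrt hd.le] at h5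
      simp at this
      rw [one_div, inv_mul_le_iff₀ (by exact_mod_cast hn)]
      exact this
    exact absurd hu (not_lt.mpr hle)
end GM

namespace GM

lemma radial (σ : ℝ) (hσ : 0 < σ) (n : ℕ) (hn : 0 < n) :
    ∃ K : ℝ, ∀ g : ℝ → ℝ, ∫ z, g (Real.sqrt (∑ i, z i ^ 2)) ∂(gaussPi σ n)
      = K * ∫ y, phi (2 / Real.sqrt (2 * n)) y
          * g (σ * Real.sqrt n * Real.exp (y / Real.sqrt (2 * n))) := by
  have hnr : (0 : ℝ) < n := by exact_mod_cast hn
  have : Nonempty (Fin n) := ⟨⟨0, hn⟩⟩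
  set w : ℝ := Real.sqrt (2 * n) with hw
  have hwpos : 0 < w := by positivity
  have hw2 : w ^ 2 = 2 * n := Real.sq_sqrt (by positivity)
  set s : ℝ := σ * Real.sqrt n with hs
  have hspos : 0 < s := by positivity
  have hs2 : s ^ 2 = σ ^ 2 * n := by rw [hs, mul_pow, Real.sq_sqrt hnr.le]
  set c : ℝ := ((Real.sqrt (2 * π * σ ^ 2))⁻¹) ^ n with hc
  set ω : ℝ := volume.real (Metric.ball (0 : EuclideanSpace ℝ (Fin n)) 1) with hω
  refine ⟨n * ω * (s ^ n / w * c * Real.exp (-(n / 2))), fun g => ?_⟩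
  have step1 : ∫ z, g (Real.sqrt (∑ i, z i ^ 2)) ∂(gaussPi σ n)
      = ∫ z : Fin n → ℝ, gdens σ n (∑ i, z i ^ 2) * g (Real.sqrt (∑ i, z i ^ 2)) := by
    rw [gaussPi_eq σ hσ n, integral_withDensity_eq_integral_toReal_smul]
    · refine integral_congr_ae (Eventually.of_forall fun z => ?_)
      simp only [smul_eq_mul]
      rw [ENNReal.toReal_ofReal]
      unfold gdens; positivity
    · unfold gdens; fun_prop
    · exact Eventually.of_forall fun z => ENNReal.ofReal_lt_top
  have step2 : ∫ z : Fin n → ℝ, gdens σ n (∑ i, z i ^ 2) * g (Real.sqrt (∑ i, z i ^ 2))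
      = ∫ x : EuclideanSpace ℝ (Fin n), gdens σ n (‖x‖ ^ 2) * g ‖x‖ := by
    rw [← (PiLp.volume_preserving_toLp (Fin n)).integral_comp
      (MeasurableEquiv.toLp 2 (Fin n → ℝ)).measurableEmbedding]
    refine integral_congr_ae (Eventually.of_forall fun z => ?_)
    simp only
    have : ‖(WithLp.toLp 2 z : EuclideanSpace ℝ (Fin n))‖ = Real.sqrt (∑ i, z i ^ 2) := by
      rw [EuclideanSpace.norm_eq]; simp
    rw [this, Real.sq_sqrt (Finset.sum_nonneg fun i _ => sq_nonneg _)]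
  have step3 := integral_fun_norm_addHaar (volume : Measure (EuclideanSpace ℝ (Fin n)))
    (fun r => gdens σ n (r ^ 2) * g r)
  have himg : Set.Ioi (0 : ℝ) = (fun y => s * Real.exp (y / w)) '' Set.univ := by
    ext x
    simp only [Set.mem_Ioi, Set.image_univ, Set.mem_range]
    constructor
    · intro hx
      refine ⟨w * Real.log (x / s), ?_⟩
      rw [mul_div_cancel_left₀ _ hwpos.ne', Real.exp_log (by positivity)]
      field_simp
    · rintro ⟨y, rfl⟩; positivity
  have hder : ∀ y ∈ (Set.univ : Set ℝ), HasDerivWithinAt (fun y => s * Real.exp (y / w))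
      (s * (Real.exp (y / w) * (1 / w))) Set.univ y := by
    intro y _
    exact ((((hasDerivAt_id y).div_const w).exp).const_mul s).hasDerivWithinAt
  have hinj : Set.InjOn (fun y => s * Real.exp (y / w)) Set.univ := by
    intro x _ y _ hxy
    have h1 : Real.exp (x / w) = Real.exp (y / w) := mul_left_cancel₀ hspos.ne' hxy
    have h2 := Real.exp_injective h1
    field_simp at h2
    exact h2
  rw [step1, step2, step3, himg, integral_image_eq_integral_abs_deriv_smul MeasurableSet.univ hder hinj,
    setIntegral_univ]
  simp only [finrank_euclideanSpace, Fintype.card_fin, nsmul_eq_mul, smul_eq_mul, ← hω]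
  rw [mul_assoc (n * ω), mul_assoc (n : ℝ) ω]
  refine congrArg (fun x => (n : ℝ) * (ω * x)) ?_
  rw [← integral_const_mul]
  refine integral_congr_ae (Eventually.of_forall fun y => ?_)
  simp only
  rw [abs_of_pos (by positivity)]
  have hpw : ∀ x : ℝ, x * x ^ (n - 1) = x ^ n := fun x => by
    rw [← pow_succ', Nat.sub_add_cancel hn]
  have e1 : gdens σ n ((s * Real.exp (y / w)) ^ 2)
      = c * Real.exp (-(n / 2 * Real.exp (2 / w * y))) := by
    unfold gdens
    rw [← hc, mul_pow, hs2, ← Real.exp_nat_mul]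
    congr 2
    rw [show ((2 : ℕ) : ℝ) * (y / w) = 2 / w * y by push_cast; ring]
    field_simp
  have e2 : (s * Real.exp (y / w)) ^ n = s ^ n * Real.exp (n / 2 * (2 / w * y)) := by
    rw [mul_pow, ← Real.exp_nat_mul]
    congr 2
    ring
  have e3 : phi (2 / w) y = Real.exp (n / 2) * (Real.exp (n / 2 * (2 / w * y)) *
      Real.exp (-(n / 2 * Real.exp (2 / w * y)))) := by
    unfold phi
    rw [← Real.exp_add, ← Real.exp_add]
    congr 1
    have : (2 / w) ^ 2 = 2 / n := by rw [div_pow, hw2]; field_simp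
    rw [this]
    field_simp
    ring
  have e4 : s * (Real.exp (y / w) * (1 / w)) * ((s * Real.exp (y / w)) ^ (n - 1) *
      (gdens σ n ((s * Real.exp (y / w)) ^ 2) * g (s * Real.exp (y / w))))
      = (1 / w) * ((s * Real.exp (y / w)) * (s * Real.exp (y / w)) ^ (n - 1)) *
        gdens σ n ((s * Real.exp (y / w)) ^ 2) * g (s * Real.exp (y / w)) := by ring
  have e5 : Real.exp (-((n : ℝ) / 2)) * Real.exp (n / 2) = 1 := by
    rw [← Real.exp_add]; simp
  rw [e4, hpw, e1, e2, e3]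
  linear_combination (-(s ^ n / w * c * Real.exp (n / 2 * (2 / w * y)) *
      Real.exp (-(n / 2 * Real.exp (2 / w * y))) * g (s * Real.exp (y / w)))) * e5

lemma ball_prob (σ : ℝ) (hσ : 0 < σ) (n : ℕ) (hn : 0 < n) (ε t : ℝ)
    (hlt : ∫ y in Set.Iic t, phi (2 / Real.sqrt (2 * n)) y
      < (1 - ε) * ∫ y, phi (2 / Real.sqrt (2 * n)) y) :
    (gaussPi σ n).real (eball n 0 (σ * Real.sqrt n * Real.exp (t / Real.sqrt (2 * n)))) < 1 - ε := by
  obtain ⟨K, hK⟩ := radial σ hσ n hn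
  have hnr : (0 : ℝ) < n := by exact_mod_cast hn
  set w : ℝ := Real.sqrt (2 * n) with hw
  have hwpos : 0 < w := by positivity
  set s : ℝ := σ * Real.sqrt n with hs
  have hspos : 0 < s := by positivity
  set r := s * Real.exp (t / w) with hr
  have hrpos : 0 < r := by positivity
  have k1 := hK (fun _ => 1)
  simp at k1
  have k2 := hK ((Set.Iic r).indicator 1)
  have k3 : ∀ z : Fin n → ℝ, (Set.Iic r).indicator (1 : ℝ → ℝ) (Real.sqrt (∑ i, z i ^ 2))
      = (eball n 0 r).indicator 1 z := by
    intro z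
    have : Real.sqrt (∑ i, z i ^ 2) ∈ Set.Iic r ↔ z ∈ eball n 0 r := by
      rw [Set.mem_Iic, Real.sqrt_le_left hrpos.le]
      simp [eball]
    by_cases h : z ∈ eball n 0 r
    · rw [Set.indicator_of_mem h, Set.indicator_of_mem (this.mpr h)]; rfl
    · rw [Set.indicator_of_notMem h, Set.indicator_of_notMem (fun h' => h (this.mp h'))]
  have k4 : ∀ y : ℝ, phi (2 / w) y * (Set.Iic r).indicator (1 : ℝ → ℝ) (s * Real.exp (y / w))
      = (Set.Iic t).indicator (phi (2 / w)) y := by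
    intro y
    have : s * Real.exp (y / w) ∈ Set.Iic r ↔ y ∈ Set.Iic t := by
      rw [Set.mem_Iic, Set.mem_Iic, hr, mul_le_mul_iff_right₀ hspos, Real.exp_le_exp,
        div_le_div_iff_of_pos_right hwpos]
    by_cases h : y ∈ Set.Iic t
    · rw [Set.indicator_of_mem h, Set.indicator_of_mem (this.mpr h)]; simp
    · rw [Set.indicator_of_notMem h, Set.indicator_of_notMem (fun h' => h (this.mp h'))]; simp
  simp_rw [k3, k4] at k2
  rw [integral_indicator_one (eball_meas n 0 r), integral_indicator measurableSet_Iic] at k2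
  rw [k2]
  have hT : 0 ≤ ∫ y, phi (2 / w) y := integral_nonneg fun y => (Real.exp_pos _).le
  have hKpos : 0 < K := by
    by_contra h
    push Not at h
    nlinarith
  calc _ < K * ((1 - ε) * ∫ y, phi (2 / w) y) := by gcongr
    _ = (1 - ε) * (K * ∫ y, phi (2 / w) y) := by ring
    _ = 1 - ε := by rw [← k1]; ring

lemma code_bound (a σ : ℝ) (hσ : 0 < σ) (n M : ℕ) (hn : 0 < n) (d ε : ℝ) (hd : 0 < d)
    (hε : 0 < ε) (hcode : IsCode a σ n M d ε) (r : ℝ) (hr : 0 ≤ r)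
    (hM : M * (Real.sqrt (n * d)) ^ n ≤ r ^ n) :
    1 - ε ≤ (gaussPi σ n).real (eball n 0 r) := by
  have hnr : (0 : ℝ) < n := by exact_mod_cast hn
  obtain ⟨f, g, hf, hfg⟩ := hcode
  set E : Set (Fin n → ℝ) := ⋃ m : Fin M, evolve a n ⁻¹' (eball n (g m) (Real.sqrt (n * d))) with hE
  have hEm : MeasurableSet E :=
    MeasurableSet.iUnion fun m => evolve_meas a n (eball_meas n _ _)
  have h1 : gaussPi σ n Eᶜ ≤ ENNReal.ofReal ε := by
    refine le_trans (measure_mono ?_) ((Measure.le_map_apply (evolve_meas a n).aemeasurable _).trans hfg)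
    intro z hz
    simp only [hE, Set.mem_compl_iff, Set.mem_iUnion, not_exists] at hz
    have := hz (f (evolve a n z))
    simp only [Set.mem_preimage, eball, Set.mem_ofPred_eq, not_le] at this ⊢
    rw [Real.sq_sqrt (by positivity)] at this
    unfold distortion
    rw [one_div, lt_inv_mul_iff₀ hnr]
    exact this
  have h2 : volume E ≤ volume (eball n 0 r) := by
    calc volume E ≤ ∑ m : Fin M, volume (evolve a n ⁻¹' (eball n (g m) (Real.sqrt (n * d)))) :=
          measure_iUnion_fintype_le _ _
      _ = M * (ENNReal.ofReal (Real.sqrt (n * d) ^ n) *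
          volume (Metric.ball (0 : EuclideanSpace ℝ (Fin n)) 1)) := by
          simp_rw [evolve_vol, eball_vol _ _ _ (Real.sqrt_nonneg (n * d))]
          rw [Finset.sum_const, Finset.card_univ, Fintype.card_fin, nsmul_eq_mul]
      _ = ENNReal.ofReal (M * Real.sqrt (n * d) ^ n) *
          volume (Metric.ball (0 : EuclideanSpace ℝ (Fin n)) 1) := by
          rw [← mul_assoc, ENNReal.ofReal_mul (by positivity), ENNReal.ofReal_natCast]
      _ ≤ _ := by
          rw [eball_vol _ _ _ hr]
          gcongr
  have h3 := bathtub σ hσ n r hr E hEm h2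
  have h4 : (gaussPi σ n).real Eᶜ ≤ ε := ENNReal.toReal_le_of_le_ofReal hε.le h1
  rw [probReal_compl_eq_one_sub hEm] at h4
  have h5 : (gaussPi σ n).real E ≤ (gaussPi σ n).real (eball n 0 r) :=
    ENNReal.toReal_mono (measure_ne_top _ _) h3
  linarith
end GM

theorem stmt12 (a σ ε d Qinv : ℝ)
    (ha0 : 0 ≤ a) (ha1 : a < 1) (hσ : 0 < σ)
    (hε : ε ∈ Set.Ioo (0 : ℝ) 1)
    (hd0 : 0 < d) (hdmax : d < σ ^ 2 / (1 - a ^ 2))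
    (hQinv : GM.gaussQ Qinv = ε) :
    ∃ C : ℝ, 0 < C ∧ ∀ᶠ n : ℕ in Filter.atTop,
      (1 / 2) * Real.log (σ ^ 2 / d) + Qinv / Real.sqrt (2 * n) - C / n
        ≤ GM.rate a σ n d ε := by
  obtain ⟨C, hC, hmain⟩ := GM.analysis ε Qinv hε hQinv
  refine ⟨C, hC, ?_⟩
  have hlim : Tendsto (fun n : ℕ => 2 / Real.sqrt (2 * (n : ℝ))) atTop (nhds 0) := by
    apply Tendsto.div_atTop tendsto_const_nhds
    exact Real.tendsto_sqrt_atTop.comp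
      (tendsto_natCast_atTop_atTop.const_mul_atTop (by norm_num))
  have hlim2 : Tendsto (fun n : ℕ => C * (2 / Real.sqrt (2 * (n : ℝ)))) atTop (nhds 0) := by
    simpa using hlim.const_mul C
  filter_upwards [eventually_gt_atTop 0, hlim.eventually (gt_mem_nhds (show (0 : ℝ) < 1 / 3 by norm_num)),
    hlim2.eventually (gt_mem_nhds (show (0 : ℝ) < 1 by norm_num))] with n hn hh1 hh2
  have hnr : (0 : ℝ) < n := by exact_mod_cast hn
  set w : ℝ := Real.sqrt (2 * n) with hw
  have hwpos : 0 < w := by positivity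
  have hw2 : w * w = 2 * n := Real.mul_self_sqrt (by positivity)
  have hlt := hmain (2 / w) (by positivity) hh1.le hh2.le
  set t := Qinv - C * (2 / w) with ht
  have hball := GM.ball_prob σ hσ n hn ε t hlt
  have hcode : GM.IsCode a σ n (GM.Mstar a σ n d ε) d ε :=
    Nat.sInf_mem (GM.code_exists a σ n hn d ε hd0 hε.1)
  by_contra hcon
  push Not at hcon
  unfold GM.rate at hcon
  set M := GM.Mstar a σ n d ε with hM
  have hMpos : 0 < M := by
    obtain ⟨f, -⟩ := hcode
    exact (f 0).pos
  have hMr : (0 : ℝ) < M := by exact_mod_cast hMpos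
  have ht2 : Qinv / w - C / n = t / w := by
    rw [ht]; field_simp; nlinarith
  have hkey : (M : ℝ) * (Real.sqrt (n * d)) ^ n
      ≤ (σ * Real.sqrt n * Real.exp (t / w)) ^ n := by
    rw [← Real.log_le_log_iff (by positivity) (by positivity), Real.log_mul (by positivity) (by positivity),
      Real.log_pow, Real.log_pow, Real.log_mul (by positivity) (by positivity),
      Real.log_mul (by positivity) (by positivity), Real.log_exp, Real.log_sqrt (by positivity),
      Real.log_sqrt (by positivity), Real.log_mul (by positivity) (by positivity)]
    rw [Real.log_div (by positivity) (by positivity), Real.log_pow, add_sub_assoc, ht2,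
      div_lt_iff₀ hnr] at hcon
    push_cast at hcon
    nlinarith
  have := GM.code_bound a σ hσ n M hn d ε hd0 hε.1 hcode _ (by positivity) hkey
  linarith

end
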